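/- If a tree T of order n(T) ≥ 2 satisfies γ_t^{oi}(S(T)) = (4n(T) − l(T) + s(T) − 2)/3, then T belongs to the family 𝒯. -/

import Mathlib

open SimpleGraph

universe u

/-- A total outer-independent dominating set: every vertex has a neighbor in `D`,
and the complement of `D` is an independent set. -/
def IsTOIDS {V : Type u} (G : SimpleGraph V) (D : Set V) : Prop :=
  (∀ v : V, ∃ u ∈ D, G.Adj v u) ∧ ∀ u ∉ D, ∀ w ∉ D, ¬ G.Adj u w

/-- The total outer-independent domination number. -/
noncomputable def toidNumber {V : Type u} (G : SimpleGraph V) : ℕ :=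
  sInf {n : ℕ | ∃ D : Set V, IsTOIDS G D ∧ D.ncard = n}

/-- The subdivision graph: each edge is replaced by a new vertex adjacent exactly to
its two endpoints. -/
def subdivision {V : Type u} (G : SimpleGraph V) : SimpleGraph (V ⊕ G.edgeSet) :=
  SimpleGraph.fromRel fun x y =>
    ∃ (v : V) (e : G.edgeSet), x = Sum.inl v ∧ y = Sum.inr e ∧ v ∈ (e : Sym2 V)

/-- A leaf: a vertex with exactly one neighbor. -/
def IsLeafVert {V : Type u} (G : SimpleGraph V) (v : V) : Prop := ∃! u, G.Adj v u

/-- A support vertex: a vertex adjacent to a leaf. -/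
def IsSupportVert {V : Type u} (G : SimpleGraph V) (v : V) : Prop :=
  ∃ u, G.Adj v u ∧ IsLeafVert G u

/-- A strong support vertex: a vertex adjacent to at least two leaves. -/
def IsStrongSupportVert {V : Type u} (G : SimpleGraph V) (v : V) : Prop :=
  ∃ u w, u ≠ w ∧ G.Adj v u ∧ G.Adj v w ∧ IsLeafVert G u ∧ IsLeafVert G w

/-- A strong leaf: a leaf adjacent to a strong support vertex. -/
def IsStrongLeaf {V : Type u} (G : SimpleGraph V) (v : V) : Prop :=
  IsLeafVert G v ∧ ∃ u, G.Adj v u ∧ IsStrongSupportVert G u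

/-- A weak leaf: a leaf that is not a strong leaf. -/
def IsWeakLeaf {V : Type u} (G : SimpleGraph V) (v : V) : Prop :=
  IsLeafVert G v ∧ ¬ IsStrongLeaf G v

/-- A semi-support vertex: neither a leaf nor a support vertex, but adjacent to a
support vertex. -/
def IsSemiSupportVert {V : Type u} (G : SimpleGraph V) (v : V) : Prop :=
  ¬ IsLeafVert G v ∧ ¬ IsSupportVert G v ∧ ∃ u, G.Adj v u ∧ IsSupportVert G u

/-- The number of leaves, with the convention that `P₂` has exactly one leaf. -/
noncomputable def leafCount {V : Type u} (G : SimpleGraph V) : ℕ :=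
  if Nat.card V = 2 then 1 else {v | IsLeafVert G v}.ncard

/-- The number of support vertices, with the convention that `P₂` has exactly one
support vertex. -/
noncomputable def supportCount {V : Type u} (G : SimpleGraph V) : ℕ :=
  if Nat.card V = 2 then 1 else {v | IsSupportVert G v}.ncard

/-- The graph obtained from `G` by attaching a path `P_r` to the vertex `v`:
the new vertices form a path `p₀ p₁ ⋯ p_{r-1}` and `v` is joined to the end `p₀`. -/
def attachPath {V : Type u} (G : SimpleGraph V) (v : V) (r : ℕ) :
    SimpleGraph (V ⊕ Fin r) :=
  SimpleGraph.fromRel fun x y =>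
    (∃ a b, x = Sum.inl a ∧ y = Sum.inl b ∧ G.Adj a b) ∨
    (∃ i j : Fin r, x = Sum.inr i ∧ y = Sum.inr j ∧ (j : ℕ) = (i : ℕ) + 1) ∨
    (∃ i : Fin r, x = Sum.inl v ∧ y = Sum.inr i ∧ (i : ℕ) = 0)

/-- The graph obtained from `G` by adding a disjoint copy of the tree `Q_r`
(`r` paths `P₃` joined to a central vertex) and identifying the central vertex
of `Q_r` with the vertex `v` of `G`. -/
def attachQ {V : Type u} (G : SimpleGraph V) (v : V) (r : ℕ) :
    SimpleGraph (V ⊕ Fin r × Fin 3) :=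
  SimpleGraph.fromRel fun x y =>
    (∃ a b, x = Sum.inl a ∧ y = Sum.inl b ∧ G.Adj a b) ∨
    (∃ i : Fin r, x = Sum.inl v ∧ y = Sum.inr (i, 0)) ∨
    (∃ (i : Fin r) (j k : Fin 3),
      x = Sum.inr (i, j) ∧ y = Sum.inr (i, k) ∧ (k : ℕ) = (j : ℕ) + 1)

/-- The family `F`: all trees obtainable from `P₂` by repeatedly
(F1) attaching `P₁` to a support vertex, (F2) attaching `P₂` to a support or
semi-support vertex, (F3) attaching `P₃` to a weak leaf. -/
inductive InFamilyF : {W : Type u} → SimpleGraph W → Prop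
  | base {W : Type u} (G : SimpleGraph W) (e : G ≃g SimpleGraph.pathGraph 2) :
      InFamilyF G
  | op1 {W : Type u} {G' : SimpleGraph W} {v : W} (hv : IsSupportVert G' v)
      (hF : InFamilyF G') {U : Type u} (G : SimpleGraph U)
      (e : G ≃g attachPath G' v 1) : InFamilyF G
  | op2 {W : Type u} {G' : SimpleGraph W} {v : W}
      (hv : IsSupportVert G' v ∨ IsSemiSupportVert G' v)
      (hF : InFamilyF G') {U : Type u} (G : SimpleGraph U)
      (e : G ≃g attachPath G' v 2) : InFamilyF G
  | op3 {W : Type u} {G' : SimpleGraph W} {v : W} (hv : IsWeakLeaf G' v)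
      (hF : InFamilyF G') {U : Type u} (G : SimpleGraph U)
      (e : G ≃g attachPath G' v 3) : InFamilyF G

/-- The family `𝒯`: all trees obtainable from `P₂` by repeatedly
(O1) attaching `P₁` to a support vertex, (O2) attaching `P₃` to a support vertex or a
weak leaf, (O3) adding a copy of `Q_r` (`r ≥ 2`) identifying its central vertex with a
weak leaf. -/
inductive InFamilyT : {W : Type u} → SimpleGraph W → Prop
  | base {W : Type u} (G : SimpleGraph W) (e : G ≃g SimpleGraph.pathGraph 2) :
      InFamilyT G
  | op1 {W : Type u} {G' : SimpleGraph W} {v : W} (hv : IsSupportVert G' v)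
      (hF : InFamilyT G') {U : Type u} (G : SimpleGraph U)
      (e : G ≃g attachPath G' v 1) : InFamilyT G
  | op2 {W : Type u} {G' : SimpleGraph W} {v : W}
      (hv : IsSupportVert G' v ∨ IsWeakLeaf G' v)
      (hF : InFamilyT G') {U : Type u} (G : SimpleGraph U)
      (e : G ≃g attachPath G' v 3) : InFamilyT G
  | op3 {W : Type u} {G' : SimpleGraph W} {v : W} (hv : IsWeakLeaf G' v)
      (hF : InFamilyT G') {r : ℕ} (hr : 2 ≤ r) {U : Type u} (G : SimpleGraph U)
      (e : G ≃g attachQ G' v r) : InFamilyT G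

/-- A vertex set `A` and an edge set `F` that together encode a total outer-independent
dominating set of the subdivision of the subgraph of `G` induced by `S`. -/
structure IsCoverPair {V : Type u} (G : SimpleGraph V) (S A : Set V) (F : Set (Sym2 V)) :
    Prop where
  cover : ∀ v ∈ S, ∃ w ∈ S, G.Adj v w ∧ s(v, w) ∈ F
  vertexCover : ∀ v ∈ S, ∀ w ∈ S, G.Adj v w → v ∈ A ∨ w ∈ A
  incidence : ∀ v ∈ S, ∀ w ∈ S, G.Adj v w → v ∈ A ∨ s(v, w) ∈ F

lemma subdivision_adj_inl_inr {V : Type u} {G : SimpleGraph V} {v : V} {e : G.edgeSet} :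
    (subdivision G).Adj (Sum.inl v) (Sum.inr e) ↔ v ∈ (e : Sym2 V) := by
  simp [subdivision]

lemma subdivision_adj_inr_inl {V : Type u} {G : SimpleGraph V} {v : V} {e : G.edgeSet} :
    (subdivision G).Adj (Sum.inr e) (Sum.inl v) ↔ v ∈ (e : Sym2 V) := by
  simp [subdivision]

lemma subdivision_not_adj_inl_inl {V : Type u} {G : SimpleGraph V} {v w : V} :
    ¬ (subdivision G).Adj (Sum.inl v) (Sum.inl w) := by
  simp [subdivision]

lemma subdivision_not_adj_inr_inr {V : Type u} {G : SimpleGraph V} {e f : G.edgeSet} :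
    ¬ (subdivision G).Adj (Sum.inr e) (Sum.inr f) := by
  simp [subdivision]

lemma IsCoverPair.toidNumber_le {V : Type u} [Finite V] {G : SimpleGraph V} {A : Set V}
    {F : Set (Sym2 V)} (h : IsCoverPair G Set.univ A F) :
    toidNumber (subdivision G) ≤ A.ncard + F.ncard := by
  have hD : IsTOIDS (subdivision G) (Sum.inl '' A ∪ Sum.inr '' {e : G.edgeSet | ↑e ∈ F}) := by
    constructor
    · rintro (v | ⟨e, he⟩)
      · obtain ⟨w, -, hvw, hF⟩ := h.cover v trivial
        exact ⟨Sum.inr ⟨s(v, w), hvw⟩, by simpa using hF,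
          subdivision_adj_inl_inr.2 (Sym2.mem_mk_left v w)⟩
      · induction e using Sym2.ind with
        | _ v w =>
          rcases h.vertexCover v trivial w trivial he with hv | hw
          · exact ⟨Sum.inl v, by simpa using hv,
              subdivision_adj_inr_inl.2 (Sym2.mem_mk_left v w)⟩
          · exact ⟨Sum.inl w, by simpa using hw,
              subdivision_adj_inr_inl.2 (Sym2.mem_mk_right v w)⟩
    · have key : ∀ v (e : G.edgeSet), v ∈ (e : Sym2 V) → v ∈ A ∨ (e : Sym2 V) ∈ F := by
        rintro v ⟨e, he⟩ hv
        obtain ⟨w, rfl⟩ := Sym2.mem_iff_exists.1 hv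
        exact h.incidence v trivial w trivial he
      rintro (v | e) hu (w | f) hw hadj
      · exact subdivision_not_adj_inl_inl hadj
      · rcases key v f (subdivision_adj_inl_inr.1 hadj) with h1 | h1
        · exact hu (by simpa using h1)
        · exact hw (by simpa using h1)
      · rcases key w e (subdivision_adj_inr_inl.1 hadj) with h1 | h1
        · exact hw (by simpa using h1)
        · exact hu (by simpa using h1)
      · exact subdivision_not_adj_inr_inr hadj
  refine (Nat.sInf_le ⟨_, hD, rfl⟩ : toidNumber (subdivision G) ≤ _).trans
    ((Set.ncard_union_le _ _).trans (add_le_add (Set.ncard_image_le (Set.toFinite A)) ?_))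
  rw [Set.ncard_image_of_injective _ Sum.inr_injective,
    ← Set.ncard_image_of_injective _ Subtype.val_injective]
  refine Set.ncard_le_ncard ?_ (Set.toFinite F)
  rintro _ ⟨e, he, rfl⟩
  exact he

lemma exists_isCoverPair_univ {V : Type u} [Finite V] {G : SimpleGraph V}
    (hG : ∀ v, ∃ w, G.Adj v w) :
    ∃ A F, IsCoverPair G Set.univ A F ∧ A.ncard + F.ncard = toidNumber (subdivision G) := by
  have hne : {n : ℕ | ∃ D, IsTOIDS (subdivision G) D ∧ D.ncard = n}.Nonempty := by
    refine ⟨_, Set.univ, ⟨?_, by simp⟩, rfl⟩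
    rintro (v | ⟨e, he⟩)
    · obtain ⟨w, hw⟩ := hG v
      exact ⟨Sum.inr ⟨s(v, w), hw⟩, trivial,
        subdivision_adj_inl_inr.2 (Sym2.mem_mk_left v w)⟩
    · induction e using Sym2.ind with
      | _ v w => exact ⟨Sum.inl v, trivial, subdivision_adj_inr_inl.2 (Sym2.mem_mk_left v w)⟩
  obtain ⟨D, ⟨hdom, hind⟩, hcard⟩ := Nat.sInf_mem hne
  refine ⟨Sum.inl ⁻¹' D, Subtype.val '' (Sum.inr ⁻¹' D), ⟨?_, ?_, ?_⟩, ?_⟩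
  · intro v _
    obtain ⟨w | ⟨e, he⟩, hD, hadj⟩ := hdom (Sum.inl v)
    · exact absurd hadj subdivision_not_adj_inl_inl
    · obtain ⟨w, rfl⟩ := Sym2.mem_iff_exists.1 (subdivision_adj_inl_inr.1 hadj)
      exact ⟨w, trivial, he, ⟨_, he⟩, hD, rfl⟩
  · intro v _ w _ hvw
    obtain ⟨x | e, hD, hadj⟩ := hdom (Sum.inr ⟨s(v, w), hvw⟩)
    · rcases Sym2.mem_iff.1 (subdivision_adj_inr_inl.1 hadj) with rfl | rfl
      · exact Or.inl hD
      · exact Or.inr hD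
    · exact absurd hadj subdivision_not_adj_inr_inr
  · intro v _ w _ hvw
    by_contra! hcon
    exact hind (Sum.inl v) hcon.1 (Sum.inr ⟨s(v, w), hvw⟩)
      (fun hD => hcon.2 ⟨_, hD, rfl⟩) (subdivision_adj_inl_inr.2 (Sym2.mem_mk_left v w))
  · rw [Set.ncard_image_of_injective _ Subtype.val_injective, toidNumber, ← hcard,
      ← Set.ncard_image_of_injective (Sum.inl ⁻¹' D) Sum.inl_injective,
      ← Set.ncard_image_of_injective (Sum.inr ⁻¹' D) Sum.inr_injective,
      ← Set.ncard_union_eq, Set.image_preimage_inl_union_image_preimage_inr]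
    · exact Set.disjoint_image_inl_image_inr

lemma exists_isCoverPair {V : Type u} [Finite V] {G : SimpleGraph V} {S : Set V}
    (hS : ∀ v ∈ S, ∃ w ∈ S, G.Adj v w) :
    ∃ A F, IsCoverPair G S A F ∧
      A.ncard + F.ncard = toidNumber (subdivision (G.induce S)) := by
  obtain ⟨A, F, h, hcard⟩ := exists_isCoverPair_univ (G := G.induce S) (by
    rintro ⟨v, hv⟩
    obtain ⟨w, hw, hvw⟩ := hS v hv
    exact ⟨⟨w, hw⟩, hvw⟩)
  refine ⟨Subtype.val '' A, Sym2.map Subtype.val '' F, ⟨?_, ?_, ?_⟩, ?_⟩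
  · intro v hv
    obtain ⟨w, -, hvw, hF⟩ := h.cover ⟨v, hv⟩ trivial
    exact ⟨w, w.2, hvw, _, hF, rfl⟩
  · intro v hv w hw hvw
    exact (h.vertexCover ⟨v, hv⟩ trivial ⟨w, hw⟩ trivial hvw).imp
      (fun h => ⟨_, h, rfl⟩) (fun h => ⟨_, h, rfl⟩)
  · intro v hv w hw hvw
    exact (h.incidence ⟨v, hv⟩ trivial ⟨w, hw⟩ trivial hvw).imp
      (fun h => ⟨_, h, rfl⟩) (fun h => ⟨_, h, rfl⟩)
  · rw [Set.ncard_image_of_injective _ Subtype.val_injective,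
      Set.ncard_image_of_injective _ (Sym2.map.injective Subtype.val_injective), hcard]

lemma IsCoverPair.exists_mem_of_leaf {V : Type u} [Finite V] {G : SimpleGraph V} {S A : Set V}
    {F : Set (Sym2 V)} (h : IsCoverPair G S A F) {p x : V} (hp : p ∈ S) (hx : x ∈ S)
    (hpx : G.Adj p x) (hleaf : ∀ v ∈ S, G.Adj x v → v = p) :
    ∃ A', IsCoverPair G S A' F ∧ p ∈ A' ∧ A'.ncard ≤ A.ncard := by
  by_cases hpA : p ∈ A
  · exact ⟨A, h, hpA, le_rfl⟩
  have hxA : x ∈ A := (h.vertexCover p hp x hx hpx).resolve_left hpA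
  have hpF := (h.incidence p hp x hx hpx).resolve_left hpA
  refine ⟨insert p (A \ {x}), ⟨h.cover, ?_, ?_⟩, by simp, (Set.ncard_exchange hpA hxA).le⟩
  · intro v hv w hw hvw
    have := h.vertexCover v hv w hw hvw
    have := hleaf w hw
    have := hleaf v hv
    have := hvw.symm
    simp only [Set.mem_insert_iff, Set.mem_sdiff, Set.mem_singleton_iff]
    grind
  · intro v hv w hw hvw
    have := h.incidence v hv w hw hvw
    have := hleaf w hw
    have := hvw.symm
    have := Sym2.eq_swap (a := p) (b := x)
    simp only [Set.mem_insert_iff, Set.mem_sdiff, Set.mem_singleton_iff]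
    grind

lemma IsCoverPair.exists_mem_of_pendant {V : Type u} [Finite V] {G : SimpleGraph V}
    {S A : Set V} {F : Set (Sym2 V)} (h : IsCoverPair G S A F) {p y z q : V} (hp : p ∈ S)
    (hy : y ∈ S) (hz : z ∈ S) (hq : q ∈ S) (hpy : G.Adj p y) (hyp : z ≠ p)
    (hleaf : ∀ v ∈ S, G.Adj z v → v = y) (hpq : G.Adj p q) (hqy : q ≠ y) :
    ∃ A' F', IsCoverPair G S A' F' ∧ p ∈ A' ∧ A'.ncard + F'.ncard ≤ A.ncard + F.ncard := by
  by_cases hpA : p ∈ A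
  · exact ⟨A, F, h, hpA, le_rfl⟩
  have hyA : y ∈ A := (h.vertexCover p hp y hy hpy).resolve_left hpA
  have hpF := (h.incidence p hp y hy hpy).resolve_left hpA
  have hpqF := (h.incidence p hp q hq hpq).resolve_left hpA
  obtain ⟨y', hy', hzy', hzF⟩ := h.cover z hz
  obtain rfl := hleaf y' hy' hzy'
  refine ⟨insert p A, F \ {s(p, y')}, ⟨?_, ?_, ?_⟩, by simp, ?_⟩
  · intro v hv
    by_cases h1 : v = p
    · subst h1
      exact ⟨q, hq, hpq, hpqF, by simp [hqy, hpy.ne]⟩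
    by_cases h2 : v = y'
    · subst h2
      exact ⟨z, hz, hzy'.symm, by rwa [Sym2.eq_swap], by simp [hyp, hpy.ne']⟩
    · obtain ⟨w, hw, hvw, hF⟩ := h.cover v hv
      exact ⟨w, hw, hvw, hF, by simp [h1, h2]⟩
  · intro v hv w hw hvw
    have := h.vertexCover v hv w hw hvw
    simp only [Set.mem_insert_iff]
    tauto
  · intro v hv w hw hvw
    have := h.incidence v hv w hw hvw
    simp only [Set.mem_insert_iff, Set.mem_sdiff, Set.mem_singleton_iff, Sym2.eq_iff]
    grind
  · have := Set.ncard_insert_le p A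
    have := Set.ncard_sdiff_singleton_add_one hpF (Set.toFinite F)
    omega

lemma IsCoverPair.extend_leaf {V : Type u} {G : SimpleGraph V} {A : Set V} {F : Set (Sym2 V)}
    {p x : V} (h : IsCoverPair G {x}ᶜ A F) (hp : p ∈ A) (hx : ∀ v, G.Adj x v ↔ v = p) :
    IsCoverPair G Set.univ A (insert s(p, x) F) := by
  have hxp : G.Adj x p := (hx p).2 rfl
  refine ⟨?_, ?_, ?_⟩
  · intro v _
    by_cases hv : v = x
    · subst hv
      exact ⟨p, trivial, hxp, Or.inl Sym2.eq_swap⟩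
    · obtain ⟨w, -, hvw, hF⟩ := h.cover v hv
      exact ⟨w, trivial, hvw, Or.inr hF⟩
  · intro v _ w _ hvw
    have := h.vertexCover v
    have := hx v
    have := hx w
    have := hvw.symm
    simp only [Set.mem_compl_iff, Set.mem_singleton_iff] at *
    by_cases h1 : v = x <;> by_cases h2 : w = x <;> grind
  · intro v _ w _ hvw
    have := h.incidence v
    have := hx v
    have := hx w
    have := hvw.symm
    simp only [Set.mem_compl_iff, Set.mem_singleton_iff, Set.mem_insert_iff, Sym2.eq_iff] at *
    by_cases h1 : v = x <;> by_cases h2 : w = x <;> grind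

lemma IsCoverPair.extend_pendant {V : Type u} {G : SimpleGraph V} {A : Set V}
    {F : Set (Sym2 V)} {a b c : V} (h : IsCoverPair G {b, c}ᶜ A F) (ha : a ∈ A)
    (hb : ∀ v, G.Adj b v ↔ v = a ∨ v = c) (hc : ∀ v, G.Adj c v ↔ v = b) :
    IsCoverPair G Set.univ (insert b A) (insert s(b, c) F) := by
  have hbc : G.Adj b c := (hb c).2 (Or.inr rfl)
  refine ⟨?_, ?_, ?_⟩
  · intro v _
    by_cases h1 : v = b
    · subst h1
      exact ⟨c, trivial, hbc, Or.inl rfl⟩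
    by_cases h2 : v = c
    · subst h2
      exact ⟨b, trivial, hbc.symm, Or.inl Sym2.eq_swap⟩
    · obtain ⟨w, -, hvw, hF⟩ := h.cover v (by simp [h1, h2])
      exact ⟨w, trivial, hvw, Or.inr hF⟩
  · intro v _ w _ hvw
    have := h.vertexCover v
    have := hb v
    have := hb w
    have := hc v
    have := hc w
    have := hvw.symm
    simp only [Set.mem_compl_iff, Set.mem_singleton_iff, Set.mem_insert_iff] at *
    grind
  · intro v _ w _ hvw
    have := h.incidence v
    have := hb v
    have := hb w
    have := hc v
    have := hc w
    have := hvw.symm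
    simp only [Set.mem_compl_iff, Set.mem_singleton_iff, Set.mem_insert_iff, Sym2.eq_iff] at *
    grind

lemma IsCoverPair.extend_pendant_of_path {V : Type u} {G : SimpleGraph V} {A : Set V}
    {F : Set (Sym2 V)} {p a b c y z : V} (h : IsCoverPair G {a, b, c, z}ᶜ A F) (hp : p ∈ A)
    (ha : ∀ v, G.Adj a v ↔ v = p ∨ v = b) (hb : ∀ v, G.Adj b v ↔ v = a ∨ v = c)
    (hc : ∀ v, G.Adj c v ↔ v = b) (hy : ∀ v, G.Adj y v ↔ v = p ∨ v = z)
    (hz : ∀ v, G.Adj z v ↔ v = y) (hya : y ≠ a) (hyb : y ≠ b) (hyc : y ≠ c)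
    (hza : z ≠ a) (hzb : z ≠ b) :
    IsCoverPair G Set.univ (insert a (insert b (insert y A)))
        (insert s(p, a) (insert s(b, c) (insert s(y, z) (F \ {s(p, y)})))) ∧
      s(p, y) ∈ F := by
  have hpa : G.Adj a p := (ha p).2 (Or.inl rfl)
  have hbc : G.Adj b c := (hb c).2 (Or.inr rfl)
  have hyz : G.Adj y z := (hy z).2 (Or.inr rfl)
  refine ⟨⟨?_, ?_, ?_⟩, ?_⟩
  · intro v _
    by_cases h1 : v = a
    · exact ⟨p, trivial, h1 ▸ hpa, by simp [h1, Sym2.eq_swap]⟩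
    by_cases h2 : v = b
    · exact ⟨c, trivial, h2 ▸ hbc, by simp [h2]⟩
    by_cases h3 : v = c
    · exact ⟨b, trivial, h3 ▸ hbc.symm, by simp [h3]⟩
    by_cases h4 : v = y
    · exact ⟨z, trivial, h4 ▸ hyz, by simp [h4]⟩
    by_cases h5 : v = z
    · exact ⟨y, trivial, h5 ▸ hyz.symm, by simp [h5]⟩
    by_cases h6 : v = p
    · exact ⟨a, trivial, h6 ▸ hpa.symm, by simp [h6]⟩
    · obtain ⟨w, -, hvw, hF⟩ := h.cover v (by simp [h1, h2, h3, h5])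
      exact ⟨w, trivial, hvw, by simp [hF, h4, h6]⟩
  · intro v _ w _ hvw
    have := h.vertexCover v
    have := hb v
    have := hb w
    have := ha v
    have := ha w
    have := hc v
    have := hc w
    have := hz v
    have := hz w
    have := hvw.symm
    simp only [Set.mem_compl_iff, Set.mem_singleton_iff, Set.mem_insert_iff] at *
    by_cases h1 : v = z <;> by_cases h2 : w = z <;> by_cases h3 : v = c <;> by_cases h4 : w = c <;>
      grind
  · intro v _ w _ hvw
    have := h.incidence v
    have := hb v
    have := hb w
    have := ha v
    have := ha w
    have := hc v
    have := hc w
    have := hy v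
    have := hy w
    have := hz v
    have := hz w
    have := hvw.symm
    simp only [Set.mem_compl_iff, Set.mem_singleton_iff, Set.mem_insert_iff, Set.mem_sdiff,
      Sym2.eq_iff] at *
    grind
  · obtain ⟨w, hw, hyw, hF⟩ := h.cover y (by simp [hya, hyb, hyc, hyz.ne])
    rcases (hy w).1 hyw with rfl | rfl
    · rwa [Sym2.eq_swap]
    · simp at hw

/-- A family of paths `P₃`, indexed by `ι`, hanging at the vertex `p` of `G`. -/
structure IsPendantPathFamily {V : Type u} {ι : Type*} (G : SimpleGraph V) (p : V)
    (f : ι × Fin 3 → V) : Prop where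
  inj : Function.Injective f
  base_notMem : p ∉ Set.range f
  adj_zero : ∀ i v, G.Adj (f (i, 0)) v ↔ v = p ∨ v = f (i, 1)
  adj_one : ∀ i v, G.Adj (f (i, 1)) v ↔ v = f (i, 0) ∨ v = f (i, 2)
  adj_two : ∀ i v, G.Adj (f (i, 2)) v ↔ v = f (i, 1)

lemma IsPendantPathFamily.extend {V : Type u} {ι : Type*} {G : SimpleGraph V} {p : V}
    {f : ι × Fin 3 → V} (hf : IsPendantPathFamily G p f) {A : Set V} {F : Set (Sym2 V)}
    (h : IsCoverPair G (Set.range f)ᶜ A F) :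
    IsCoverPair G Set.univ
      (A ∪ (Set.range (fun i => f (i, 0)) ∪ Set.range (fun i => f (i, 1))))
      (F ∪ (Set.range (fun i => s(p, f (i, 0))) ∪ Set.range (fun i => s(f (i, 1), f (i, 2))))) := by
  have hor : ∀ v, v ∉ Set.range f ∨ (∃ i, v = f (i, 0)) ∨ (∃ i, v = f (i, 1)) ∨
      ∃ i, v = f (i, 2) := by
    intro v
    by_cases hv : v ∈ Set.range f
    · obtain ⟨⟨i, j⟩, rfl⟩ := hv
      fin_cases j
      · exact Or.inr (Or.inl ⟨i, rfl⟩)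
      · exact Or.inr (Or.inr (Or.inl ⟨i, rfl⟩))
      · exact Or.inr (Or.inr (Or.inr ⟨i, rfl⟩))
    · exact Or.inl hv
  refine ⟨?_, ?_, ?_⟩
  · intro v _
    rcases hor v with hv | ⟨i, rfl⟩ | ⟨i, rfl⟩ | ⟨i, rfl⟩
    · obtain ⟨w, -, hvw, hF⟩ := h.cover v hv
      exact ⟨w, trivial, hvw, Or.inl hF⟩
    · exact ⟨p, trivial, (hf.adj_zero i p).2 (Or.inl rfl), Or.inr (Or.inl ⟨i, Sym2.eq_swap⟩)⟩
    · exact ⟨_, trivial, (hf.adj_one i _).2 (Or.inr rfl), Or.inr (Or.inr ⟨i, rfl⟩)⟩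
    · exact ⟨_, trivial, (hf.adj_two i _).2 rfl, Or.inr (Or.inr ⟨i, Sym2.eq_swap⟩)⟩
  · intro v _ w _ hvw
    rcases hor v with hv | ⟨i, rfl⟩ | ⟨i, rfl⟩ | ⟨i, rfl⟩
    · rcases hor w with hw | ⟨i, rfl⟩ | ⟨i, rfl⟩ | ⟨i, rfl⟩
      · exact (h.vertexCover v hv w hw hvw).imp Or.inl Or.inl
      · exact Or.inr (Or.inr (Or.inl ⟨i, rfl⟩))
      · exact Or.inr (Or.inr (Or.inr ⟨i, rfl⟩))
      · exact absurd ⟨_, ((hf.adj_two i v).1 hvw.symm).symm⟩ hv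
    · exact Or.inl (Or.inr (Or.inl ⟨i, rfl⟩))
    · exact Or.inl (Or.inr (Or.inr ⟨i, rfl⟩))
    · rw [(hf.adj_two i w).1 hvw]
      exact Or.inr (Or.inr (Or.inr ⟨i, rfl⟩))
  · intro v _ w _ hvw
    rcases hor v with hv | ⟨i, rfl⟩ | ⟨i, rfl⟩ | ⟨i, rfl⟩
    · rcases hor w with hw | ⟨i, rfl⟩ | ⟨i, rfl⟩ | ⟨i, rfl⟩
      · exact (h.incidence v hv w hw hvw).imp Or.inl Or.inl
      · rcases (hf.adj_zero i v).1 hvw.symm with rfl | rfl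
        · exact Or.inr (Or.inr (Or.inl ⟨i, rfl⟩))
        · exact absurd ⟨_, rfl⟩ hv
      · rcases (hf.adj_one i v).1 hvw.symm with rfl | rfl <;> exact absurd ⟨_, rfl⟩ hv
      · exact absurd ⟨_, ((hf.adj_two i v).1 hvw.symm).symm⟩ hv
    · exact Or.inl (Or.inr (Or.inl ⟨i, rfl⟩))
    · exact Or.inl (Or.inr (Or.inr ⟨i, rfl⟩))
    · rw [(hf.adj_two i w).1 hvw]
      exact Or.inr (Or.inr (Or.inr ⟨i, Sym2.eq_swap⟩))

lemma ncard_range_le_natCard {α ι : Type*} [Finite ι] (f : ι → α) :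
    (Set.range f).ncard ≤ Nat.card ι := by
  rw [← Set.image_univ, ← Set.ncard_univ]
  exact Set.ncard_image_le

lemma IsPendantPathFamily.toidNumber_le {V : Type u} [Finite V] {ι : Type*} [Finite ι]
    {G : SimpleGraph V} {p : V} {f : ι × Fin 3 → V} (hf : IsPendantPathFamily G p f)
    (hS : ∀ v ∈ (Set.range f)ᶜ, ∃ w ∈ (Set.range f)ᶜ, G.Adj v w) :
    toidNumber (subdivision G) ≤
      toidNumber (subdivision (G.induce (Set.range f)ᶜ)) + 4 * Nat.card ι := by
  obtain ⟨A, F, h, hcard⟩ := exists_isCoverPair hS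
  refine (hf.extend h).toidNumber_le.trans ?_
  have h1 := Set.ncard_union_le A
    (Set.range (fun i => f (i, 0)) ∪ Set.range (fun i => f (i, 1)))
  have h2 := Set.ncard_union_le (Set.range (fun i => f (i, 0))) (Set.range (fun i => f (i, 1)))
  have h3 := Set.ncard_union_le F
    (Set.range (fun i => s(p, f (i, 0))) ∪ Set.range (fun i => s(f (i, 1), f (i, 2))))
  have h4 := Set.ncard_union_le (Set.range (fun i => s(p, f (i, 0))))
    (Set.range (fun i => s(f (i, 1), f (i, 2))))
  have h5 := ncard_range_le_natCard (fun i => f (i, 0))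
  have h6 := ncard_range_le_natCard (fun i => f (i, 1))
  have h7 := ncard_range_le_natCard (fun i => s(p, f (i, 0)))
  have h8 := ncard_range_le_natCard (fun i => s(f (i, 1), f (i, 2)))
  omega

lemma IsPendantPathFamily.card_compl {V : Type u} [Finite V] {ι : Type*} [Finite ι]
    {G : SimpleGraph V} {p : V} {f : ι × Fin 3 → V} (hf : IsPendantPathFamily G p f) :
    Nat.card ↥(Set.range f)ᶜ + 3 * Nat.card ι = Nat.card V := by
  rw [Nat.card_coe_set_eq, ← Set.ncard_add_ncard_compl (Set.range f),
    Set.ncard_range_of_injective hf.inj, Nat.card_prod, Nat.card_fin]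
  ring

/-- A graph is recovered by gluing the new vertices `f i` to the remaining ones. -/
noncomputable def complRangeSumEquiv {V : Type u} {ι : Type*} (f : ι → V)
    (hf : Function.Injective f) : ↥(Set.range f)ᶜ ⊕ ι ≃ V :=
  Equiv.ofBijective (Sum.elim Subtype.val f) (by
    constructor
    · rintro (⟨x, hx⟩ | i) (⟨y, hy⟩ | j) hxy
      · simpa using hxy
      · exact absurd ⟨j, hxy.symm⟩ hx
      · exact absurd ⟨i, hxy⟩ hy
      · exact congrArg Sum.inr (hf hxy)
    · intro v
      by_cases hv : v ∈ Set.range f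
      · obtain ⟨i, rfl⟩ := hv
        exact ⟨Sum.inr i, rfl⟩
      · exact ⟨Sum.inl ⟨v, hv⟩, rfl⟩)

@[simp] lemma complRangeSumEquiv_inl {V : Type u} {ι : Type*} (f : ι → V)
    (hf : Function.Injective f) (x : ↥(Set.range f)ᶜ) :
    complRangeSumEquiv f hf (Sum.inl x) = x := rfl

@[simp] lemma complRangeSumEquiv_inr {V : Type u} {ι : Type*} (f : ι → V)
    (hf : Function.Injective f) (i : ι) : complRangeSumEquiv f hf (Sum.inr i) = f i := rfl

lemma nonempty_iso_attachPath {V : Type u} {G : SimpleGraph V} {p : V} {r : ℕ} {f : Fin r → V}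
    (hf : Function.Injective f) (hp : p ∈ (Set.range f)ᶜ)
    (hadj : ∀ i j, G.Adj (f i) (f j) ↔ (j : ℕ) = i + 1 ∨ (i : ℕ) = j + 1)
    (hbase : ∀ i, ∀ v ∈ (Set.range f)ᶜ, G.Adj v (f i) ↔ v = p ∧ (i : ℕ) = 0) :
    Nonempty (G ≃g attachPath (G.induce (Set.range f)ᶜ) ⟨p, hp⟩ r) := by
  refine ⟨RelIso.symm ⟨complRangeSumEquiv f hf, ?_⟩⟩
  rintro (⟨x, hx⟩ | i) (⟨y, hy⟩ | j)
  · have := G.ne_of_adj (a := x) (b := y)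
    have := G.adj_comm x y
    simp [attachPath]
    tauto
  · simp [attachPath, hbase j x hx]
  · simp [attachPath, G.adj_comm (f i), hbase i y hy]
  · simp only [complRangeSumEquiv_inr, attachPath, hadj i j]
    simp
    rintro h rfl
    omega

lemma IsPendantPathFamily.nonempty_iso_attachQ {V : Type u} {G : SimpleGraph V} {p : V} {r : ℕ}
    {f : Fin r × Fin 3 → V} (hf : IsPendantPathFamily G p f) :
    Nonempty (G ≃g attachQ (G.induce (Set.range f)ᶜ) ⟨p, hf.base_notMem⟩ r) := by
  refine ⟨RelIso.symm ⟨complRangeSumEquiv f hf.inj, ?_⟩⟩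
  have hb : ∀ ij, f ij ≠ p := fun ij h => hf.base_notMem ⟨ij, h⟩
  have key : ∀ i j, ∀ y ∉ Set.range f, G.Adj (f (i, j)) y ↔ y = p ∧ j = 0 := by
    intro i j y hy
    have hy' : ∀ ij, y ≠ f ij := fun ij h => hy ⟨ij, h.symm⟩
    fin_cases j
    · simpa [hy'] using hf.adj_zero i y
    · simpa [hy'] using hf.adj_one i y
    · simpa [hy'] using hf.adj_two i y
  rintro (⟨x, hx⟩ | ⟨i, j⟩) (⟨y, hy⟩ | ⟨i', j'⟩)
  · have := G.ne_of_adj (a := x) (b := y)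
    have := G.adj_comm x y
    have hx' : ∀ i j, f (i, j) ≠ x := fun i j h => hx ⟨_, h⟩
    have hy' : ∀ i j, f (i, j) ≠ y := fun i j h => hy ⟨_, h⟩
    simp [attachQ, hx', hy']
    tauto
  · simp [attachQ, G.adj_comm x, key i' j' x hx]
  · simp [attachQ, key i j y hy]
  · have h0 := hf.adj_zero i (f (i', j'))
    have h1 := hf.adj_one i (f (i', j'))
    have h2 := hf.adj_two i (f (i', j'))
    simp only [hf.inj.eq_iff, hb, Prod.mk.injEq, false_or] at h0 h1 h2
    have hadj : G.Adj (f (i, j)) (f (i', j')) ↔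
        i = i' ∧ ((j' : ℕ) = j + 1 ∨ (j : ℕ) = j' + 1) := by
      fin_cases j
      · refine h0.trans ?_
        fin_cases j' <;> simp [eq_comm]
      · refine h1.trans ?_
        fin_cases j' <;> simp [eq_comm]
      · refine h2.trans ?_
        fin_cases j' <;> simp [eq_comm]
    simp only [complRangeSumEquiv_inr, hadj, attachQ, SimpleGraph.fromRel_adj]
    simp
    grind

lemma IsPendantPathFamily.nonempty_iso_attachPath {V : Type u} {G : SimpleGraph V} {p : V}
    {f : Fin 1 × Fin 3 → V} (hf : IsPendantPathFamily G p f) :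
    Nonempty (G ≃g attachPath (G.induce (Set.range f)ᶜ) ⟨p, hf.base_notMem⟩ 3) := by
  obtain ⟨e⟩ := hf.nonempty_iso_attachQ
  refine ⟨e.trans ⟨Equiv.sumCongr (Equiv.refl _) (Equiv.uniqueProd (Fin 3) (Fin 1)), ?_⟩⟩
  rintro (x | ⟨i, j⟩) (y | ⟨i', j'⟩)
  · simp [attachPath, attachQ, Equiv.uniqueProd]
  · simp [attachPath, attachQ, Equiv.uniqueProd, Subsingleton.elim i' 0]
  · simp [attachPath, attachQ, Equiv.uniqueProd, Subsingleton.elim i 0]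
  · fin_cases i; fin_cases i'
    simp [attachPath, attachQ, Equiv.uniqueProd]

lemma connected_induce_of_retraction {V : Type u} {G : SimpleGraph V} (hG : G.Connected)
    {S : Set V} (f : V → V) (hfS : ∀ v, f v ∈ S) (hf : ∀ v ∈ S, f v = v)
    (hadj : ∀ v w, G.Adj v w → f v = f w ∨ G.Adj (f v) (f w)) : (G.induce S).Connected := by
  have key : ∀ v w, G.Reachable v w →
      (G.induce S).Reachable ⟨f v, hfS v⟩ ⟨f w, hfS w⟩ := by
    rintro v w ⟨walk⟩
    induction walk with
    | nil => exact Reachable.refl _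
    | cons h _ ih =>
      refine Reachable.trans ?_ ih
      rcases hadj _ _ h with h | h
      · simp only [h]
        exact Reachable.refl _
      · exact Adj.reachable (by simpa using h)
  have := hG.nonempty
  have : Nonempty S := ⟨⟨f (Classical.arbitrary V), hfS _⟩⟩
  refine ⟨?_⟩
  rintro ⟨v, hv⟩ ⟨w, hw⟩
  simpa [hf v hv, hf w hw] using key v w (hG.preconnected v w)

lemma isTree_induce_of_gate {V : Type u} {G : SimpleGraph V} (hG : G.IsTree)
    {S : Set V} {p : V} (hp : p ∈ S) (hgate : ∀ v ∈ S, ∀ w ∉ S, G.Adj v w → v = p) :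
    (G.induce S).IsTree := by
  classical
  refine ⟨connected_induce_of_retraction hG.connected (fun v => if v ∈ S then v else p) ?_ ?_ ?_,
    hG.isAcyclic.induce S⟩
  · intro v
    split_ifs with h
    exacts [h, hp]
  · intro v hv
    simp [hv]
  · intro v w hvw
    have h1 := hgate v
    have h2 := hgate w
    have := hvw.symm
    grind

/-- No vertex is adjacent to two different leaves. -/
def HasNoStrongSupport {V : Type u} (G : SimpleGraph V) : Prop :=
  ∀ ⦃u x y⦄, G.Adj u x → G.Adj u y → IsLeafVert G x → IsLeafVert G y → x = y

lemma HasNoStrongSupport.isWeakLeaf {V : Type u} {G : SimpleGraph V} (hG : HasNoStrongSupport G)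
    {v : V} (hv : IsLeafVert G v) : IsWeakLeaf G v := by
  refine ⟨hv, ?_⟩
  rintro ⟨-, u, -, x, y, hxy, hx, hy, hlx, hly⟩
  exact hxy (hG hx hy hlx hly)

lemma exists_leaf_choice {V : Type u} (G : SimpleGraph V) :
    ∃ φ : V → V, (∀ v, IsSupportVert G v → G.Adj v (φ v) ∧ IsLeafVert G (φ v)) ∧
      Set.InjOn φ {v | IsSupportVert G v} := by
  classical
  refine ⟨fun v => if h : IsSupportVert G v then h.choose else v, ?_, ?_⟩
  · intro v hv
    simpa [hv] using hv.choose_spec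
  · intro v hv w hw hvw
    change IsSupportVert G _ at hv hw
    simp only [hv, hw, dite_true] at hvw
    have h1 := hv.choose_spec
    have h2 := hw.choose_spec
    rw [← hvw] at h2
    exact h1.2.unique h1.1.symm h2.1.symm

lemma supportCount_le_leafCount {V : Type u} [Finite V] (G : SimpleGraph V) :
    supportCount G ≤ leafCount G := by
  unfold supportCount leafCount
  split_ifs
  · exact le_rfl
  · obtain ⟨φ, hφ, hinj⟩ := exists_leaf_choice G
    exact Set.ncard_le_ncard_of_injOn φ (fun v hv => (hφ v hv).2) hinj (Set.toFinite _)

lemma HasNoStrongSupport.leafCount_le {V : Type u} [Finite V] {G : SimpleGraph V}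
    (hG : HasNoStrongSupport G) : leafCount G ≤ supportCount G := by
  unfold supportCount leafCount
  split_ifs
  · exact le_rfl
  · have : ∀ v, ∃ u, IsLeafVert G v → G.Adj v u := by
      intro v
      by_cases h : IsLeafVert G v
      · exact ⟨h.choose, fun _ => h.choose_spec.1⟩
      · exact ⟨v, fun h' => absurd h' h⟩
    choose φ hφ using this
    refine Set.ncard_le_ncard_of_injOn φ (fun v hv => ⟨v, (hφ v hv).symm, hv⟩) ?_
      (Set.toFinite _)
    intro v hv w hw hvw
    have h2 := (hφ w hw).symm
    rw [← hvw] at h2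
    exact hG (hφ v hv).symm h2 hv hw

lemma hasNoStrongSupport_of_leafCount_le {V : Type u} [Finite V] {G : SimpleGraph V}
    (h : leafCount G ≤ supportCount G) : HasNoStrongSupport G := by
  intro u x y hx hy hlx hly
  by_contra hxy
  unfold leafCount supportCount at h
  split_ifs at h with hc
  · have : ({u, x, y} : Set V).ncard = 3 := Set.ncard_eq_three.2 ⟨u, x, y, hx.ne, hy.ne, hxy, rfl⟩
    have := Set.ncard_le_card ({u, x, y} : Set V)
    omega
  · obtain ⟨φ, hφ, hinj⟩ := exists_leaf_choice G
    have himg : φ '' {v | IsSupportVert G v} = {v | IsLeafVert G v} := by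
      refine Set.eq_of_subset_of_ncard_le ?_ ?_ (Set.toFinite _)
      · rintro _ ⟨v, hv, rfl⟩
        exact (hφ v hv).2
      · rwa [hinj.ncard_image]
    have key : ∀ z, G.Adj u z → IsLeafVert G z → z = φ u := by
      intro z hz hlz
      obtain ⟨v, hv, rfl⟩ := himg.symm.subset hlz
      rw [hlz.unique hz.symm (hφ v hv).1.symm]
    exact hxy ((key x hx hlx).trans (key y hy hly).symm)

lemma card_eq_two_of_adj_leaves {V : Type u} {G : SimpleGraph V} (hG : G.Connected) {u v : V}
    (huv : G.Adj u v) (hu : IsLeafVert G u) (hv : IsLeafVert G v) : Nat.card V = 2 := by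
  have key : ∀ w, G.Reachable u w → w ∈ ({u, v} : Set V) := by
    intro w hw
    rw [SimpleGraph.reachable_iff_reflTransGen] at hw
    induction hw with
    | refl => simp
    | tail _ h ih =>
      rcases ih with rfl | rfl
      · exact Or.inr (hu.unique h huv)
      · exact Or.inl (hv.unique h huv.symm)
  have huniv : ({u, v} : Set V) = Set.univ := Set.eq_univ_of_forall fun w => key w (hG.preconnected u w)
  rw [← Set.ncard_univ, ← huniv, Set.ncard_pair huv.ne]

lemma isLeafVert_of_forall {V : Type u} {G : SimpleGraph V} {x p : V}
    (h : ∀ v, G.Adj x v ↔ v = p) : IsLeafVert G x :=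
  ⟨p, (h p).2 rfl, fun v hv => (h v).1 hv⟩

lemma IsLeafVert.adj_iff {V : Type u} {G : SimpleGraph V} {x p : V} (hx : IsLeafVert G x)
    (hp : G.Adj x p) (v : V) : G.Adj x v ↔ v = p :=
  ⟨fun h => hx.unique h hp, fun h => h ▸ hp⟩

lemma exists_adj_of_connected_induce {V : Type u} {G : SimpleGraph V} {S : Set V} [Finite V]
    (hS : (G.induce S).Connected) (hcard : 2 ≤ Nat.card S) : ∀ v ∈ S, ∃ w ∈ S, G.Adj v w := by
  intro v hv
  have : Nontrivial S := Finite.one_lt_card_iff_nontrivial.1 hcard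
  obtain ⟨w, hw⟩ := hS.preconnected.exists_adj_of_nontrivial ⟨v, hv⟩
  exact ⟨w, w.2, hw⟩

lemma natCard_compl_add_ncard {V : Type u} [Finite V] (S : Set V) :
    Nat.card (Sᶜ : Set V) + S.ncard = Nat.card V := by
  rw [Nat.card_coe_set_eq, add_comm, Set.ncard_add_ncard_compl]

/-- The upper bound for the total outer-independent domination number of the subdivision graph,
together with the membership in `𝒯` of the graphs attaining it. -/
def SatisfiesUpperBound {V : Type u} (G : SimpleGraph V) : Prop :=
  3 * toidNumber (subdivision G) + leafCount G + 2 ≤ 4 * Nat.card V + supportCount G ∧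
    (3 * toidNumber (subdivision G) + leafCount G + 2 = 4 * Nat.card V + supportCount G →
      InFamilyT G)

lemma SatisfiesUpperBound.le {V : Type u} [Finite V] {G : SimpleGraph V}
    (h : SatisfiesUpperBound G) : 3 * toidNumber (subdivision G) + 2 ≤ 4 * Nat.card V := by
  have := h.1
  have := supportCount_le_leafCount G
  omega

lemma SatisfiesUpperBound.of_eq {V : Type u} [Finite V] {G : SimpleGraph V}
    (h : SatisfiesUpperBound G) (heq : 3 * toidNumber (subdivision G) + 2 = 4 * Nat.card V) :
    InFamilyT G ∧ HasNoStrongSupport G := by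
  have := h.1
  have := supportCount_le_leafCount G
  exact ⟨h.2 (by omega), hasNoStrongSupport_of_leafCount_le (by omega)⟩

lemma HasNoStrongSupport.satisfiesUpperBound {V : Type u} [Finite V] {G : SimpleGraph V}
    (hG : HasNoStrongSupport G)
    (hle : 3 * toidNumber (subdivision G) + 2 ≤ 4 * Nat.card V)
    (heq : 3 * toidNumber (subdivision G) + 2 = 4 * Nat.card V → InFamilyT G) :
    SatisfiesUpperBound G := by
  have := hG.leafCount_le
  have := supportCount_le_leafCount G
  exact ⟨by omega, fun h => heq (by omega)⟩

lemma satisfiesUpperBound_of_two_leaves {V : Type u} [Finite V] {G : SimpleGraph V}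
    (hG : G.IsTree) {u x y : V} (hxy : x ≠ y) (hx : ∀ v, G.Adj x v ↔ v = u)
    (hy : ∀ v, G.Adj y v ↔ v = u)
    (ih : ∀ {S : Set V}, S ≠ Set.univ → (G.induce S).IsTree → 2 ≤ Nat.card S →
      SatisfiesUpperBound (G.induce S)) : SatisfiesUpperBound G := by
  have hux : G.Adj u x := ((hx u).2 rfl).symm
  have huy : G.Adj u y := ((hy u).2 rfl).symm
  have huS : u ∈ ({x}ᶜ : Set V) := hux.ne
  have hyS : y ∈ ({x}ᶜ : Set V) := hxy.symm
  have htree : (G.induce ({x}ᶜ : Set V)).IsTree := by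
    refine isTree_induce_of_gate hG huS fun v _ w hw hvw => ?_
    obtain rfl : w = x := not_not.1 hw
    exact (hx v).1 hvw.symm
  have hcard := natCard_compl_add_ncard ({x} : Set V)
  rw [Set.ncard_singleton] at hcard
  have hcardS : 2 ≤ Nat.card ({x}ᶜ : Set V) := by
    rw [Nat.card_coe_set_eq, ← Set.ncard_pair huy.ne]
    refine Set.ncard_le_ncard ?_
    rintro v (rfl | rfl) <;> assumption
  have hu : ¬ IsLeafVert G u := fun h => hxy (h.unique hux huy)
  have hyleaf : IsLeafVert (G.induce ({x}ᶜ : Set V)) ⟨y, hyS⟩ :=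
    ⟨⟨u, huS⟩, huy.symm, fun v hv => Subtype.ext ((hy v).1 hv)⟩
  have husupp : IsSupportVert (G.induce ({x}ᶜ : Set V)) ⟨u, huS⟩ := ⟨⟨y, hyS⟩, huy, hyleaf⟩
  have hγ : toidNumber (subdivision G) ≤
      toidNumber (subdivision (G.induce ({x}ᶜ : Set V))) + 1 := by
    obtain ⟨A, F, h, hAF⟩ :=
      exists_isCoverPair (exists_adj_of_connected_induce htree.connected hcardS)
    obtain ⟨A', h', huA, hA'⟩ := h.exists_mem_of_leaf huS hyS huy fun v _ hv => (hy v).1 hv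
    have := (h'.extend_leaf huA hx).toidNumber_le
    have := Set.ncard_insert_le s(u, x) F
    omega
  have hleafsub : {v | IsLeafVert G v} ⊆
      insert x (Subtype.val '' {v | IsLeafVert (G.induce ({x}ᶜ : Set V)) v}) := by
    intro v hv
    by_cases hvx : v = x
    · exact Or.inl hvx
    · refine Or.inr ⟨⟨v, hvx⟩, ?_, rfl⟩
      obtain ⟨w, hw, hwu⟩ := hv
      have hwx : w ≠ x := by
        rintro rfl
        exact hu ((hx v).1 hw.symm ▸ ⟨w, hw, hwu⟩)
      exact ⟨⟨w, hwx⟩, hw, fun z hz => Subtype.ext (hwu z hz)⟩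
  have hsuppsub : Nat.card ({x}ᶜ : Set V) ≠ 2 →
      Subtype.val '' {v | IsSupportVert (G.induce ({x}ᶜ : Set V)) v} ⊆
        {v | IsSupportVert G v} := by
    rintro hne _ ⟨v, ⟨w, hvw, hw⟩, rfl⟩
    have hwu : w ≠ ⟨u, huS⟩ := by
      rintro rfl
      exact hne (card_eq_two_of_adj_leaves htree.connected (u := ⟨u, huS⟩) (v := ⟨y, hyS⟩) huy hw hyleaf)
    refine ⟨w, hvw, v, hvw.symm, fun z hz => ?_⟩
    have hzx : z ≠ x := by
      rintro rfl
      exact hwu (Subtype.ext ((hx w).1 hz.symm))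
    exact congrArg Subtype.val (hw.unique (y₁ := ⟨z, hzx⟩) hz hvw.symm)
  have hle := Set.ncard_le_ncard hleafsub
  have hl : leafCount G ≤ leafCount (G.induce ({x}ᶜ : Set V)) + 1 := by
    unfold leafCount
    rw [if_neg (by omega)]
    split_ifs with hc
    · have : {v | IsLeafVert G v} ⊆ {u}ᶜ := by
        rintro v hv rfl
        exact hu hv
      have := Set.ncard_le_ncard this
      have := natCard_compl_add_ncard ({u} : Set V)
      rw [Set.ncard_singleton, Nat.card_coe_set_eq] at this
      omega
    · refine hle.trans ((Set.ncard_insert_le _ _).trans ?_)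
      rw [Set.ncard_image_of_injective _ Subtype.val_injective]
  have hs : supportCount (G.induce ({x}ᶜ : Set V)) ≤ supportCount G := by
    unfold supportCount
    rw [if_neg (c := Nat.card V = 2) (by omega)]
    split_ifs with hc
    · exact (Set.ncard_pos (Set.toFinite _)).2 ⟨u, x, hux, isLeafVert_of_forall hx⟩
    · have := Set.ncard_le_ncard (hsuppsub hc)
      rwa [Set.ncard_image_of_injective _ Subtype.val_injective] at this
  obtain ⟨hle', hT'⟩ := ih (by simp) htree hcardS
  refine ⟨by omega, fun heq => ?_⟩
  have hT'' := hT' (by omega)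
  have hrange : Set.range (fun _ : Fin 1 => x) = {x} := by simp
  have hp : u ∈ (Set.range (fun _ : Fin 1 => x))ᶜ := by rwa [hrange]
  obtain ⟨e⟩ := nonempty_iso_attachPath (G := G) (p := u) (f := fun _ : Fin 1 => x)
    (Function.injective_of_subsingleton _) hp (by simp)
    (fun i v _ => by simp [G.adj_comm v x, hx v])
  have key : ∀ {S : Set V} (_ : S = {x}ᶜ), ∀ hp : u ∈ S,
      IsSupportVert (G.induce S) ⟨u, hp⟩ ∧ InFamilyT (G.induce S) := by
    rintro S rfl hp
    exact ⟨husupp, hT''⟩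
  have := key (by rw [hrange]) hp
  exact InFamilyT.op1 this.1 this.2 G e

lemma three_mul_toidNumber_lt_of_pendant {V : Type u} [Finite V] {G : SimpleGraph V}
    (hG : G.IsTree) {a b c q : V} (hb : ∀ v, G.Adj b v ↔ v = a ∨ v = c)
    (hc : ∀ v, G.Adj c v ↔ v = b) (haq : G.Adj a q) (hqb : q ≠ b)
    (hA : ∀ A F, IsCoverPair G {b, c}ᶜ A F → ∃ A' F', IsCoverPair G {b, c}ᶜ A' F' ∧ a ∈ A' ∧
      A'.ncard + F'.ncard ≤ A.ncard + F.ncard)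
    (ih : ∀ {S : Set V}, S ≠ Set.univ → (G.induce S).IsTree → 2 ≤ Nat.card S →
      SatisfiesUpperBound (G.induce S)) :
    3 * toidNumber (subdivision G) + 2 < 4 * Nat.card V := by
  have hba : G.Adj b a := (hb a).2 (Or.inl rfl)
  have hbc : G.Adj b c := (hb c).2 (Or.inr rfl)
  have hac : a ≠ c := by
    rintro rfl
    exact hqb ((hc q).1 haq)
  have hqc : q ≠ c := by
    rintro rfl
    exact hba.ne' ((hc a).1 haq.symm)
  have haS : a ∈ ({b, c}ᶜ : Set V) := by simp [hba.ne', hac]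
  have hqS : q ∈ ({b, c}ᶜ : Set V) := by simp [hqb, hqc]
  have htree : (G.induce ({b, c}ᶜ : Set V)).IsTree := by
    refine isTree_induce_of_gate hG haS fun v hv w hw hvw => ?_
    have h1 := hb v
    have h2 := hc v
    have h3 := hvw.symm
    simp only [Set.mem_compl_iff, Set.mem_insert_iff, Set.mem_singleton_iff] at hv hw
    grind
  have hcard := natCard_compl_add_ncard ({b, c} : Set V)
  rw [Set.ncard_pair hbc.ne] at hcard
  have hcardS : 2 ≤ Nat.card ({b, c}ᶜ : Set V) := by
    rw [Nat.card_coe_set_eq, ← Set.ncard_pair haq.ne]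
    refine Set.ncard_le_ncard ?_
    rintro v (rfl | rfl) <;> assumption
  obtain ⟨A, F, h, hAF⟩ :=
    exists_isCoverPair (exists_adj_of_connected_induce htree.connected hcardS)
  obtain ⟨A', F', h', haA, hA'⟩ := hA A F h
  have := (h'.extend_pendant haA hb hc).toidNumber_le
  have := Set.ncard_insert_le s(b, c) F'
  have := Set.ncard_insert_le b A'
  have := (ih ((Set.ne_univ_iff_exists_notMem _).2 ⟨b, by simp⟩) htree hcardS).le
  omega

lemma three_mul_toidNumber_lt_of_path_of_support {V : Type u} [Finite V] {G : SimpleGraph V}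
    (hG : G.IsTree) {p a b c y z : V} (ha : ∀ v, G.Adj a v ↔ v = p ∨ v = b)
    (hb : ∀ v, G.Adj b v ↔ v = a ∨ v = c) (hc : ∀ v, G.Adj c v ↔ v = b)
    (hy : ∀ v, G.Adj y v ↔ v = p ∨ v = z) (hz : ∀ v, G.Adj z v ↔ v = y)
    (hdist : [p, a, b, c, y, z].Nodup)
    (ih : ∀ {S : Set V}, S ≠ Set.univ → (G.induce S).IsTree → 2 ≤ Nat.card S →
      SatisfiesUpperBound (G.induce S)) :
    3 * toidNumber (subdivision G) + 2 < 4 * Nat.card V := by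
  classical
  simp only [List.nodup_cons, List.mem_cons, List.not_mem_nil, not_or, or_false] at hdist
  obtain ⟨⟨hpa, hpb, hpc, hpy, hpz⟩, ⟨hab, hac, hay, haz⟩, ⟨hbc, hby, hbz⟩, ⟨hcy, hcz⟩, hyz, -⟩ :=
    hdist
  have hpS : p ∈ ({a, b, c, z}ᶜ : Set V) := by simp [*]
  have hyS : y ∈ ({a, b, c, z}ᶜ : Set V) := by simp [Ne.symm, *]
  have htree : (G.induce ({a, b, c, z}ᶜ : Set V)).IsTree := by
    refine ⟨connected_induce_of_retraction hG.connected
      (fun v => if v = z then y else if v = a ∨ v = b ∨ v = c then p else v) ?_ ?_ ?_,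
      hG.isAcyclic.induce _⟩
    · intro v
      split_ifs with h1 h2
      · exact hyS
      · exact hpS
      · simp_all
    · intro v hv
      simp_all
    · intro v w hvw
      have hwv := hvw.symm
      have := ha v
      have := hb v
      have := hc v
      have := hz v
      have := ha w
      have := hb w
      have := hc w
      have := hz w
      grind
  have hcard := natCard_compl_add_ncard ({a, b, c, z} : Set V)
  have h4 : ({a, b, c, z} : Set V).ncard = 4 := by
    rw [Set.ncard_insert_of_notMem (by simp [*]), Set.ncard_insert_of_notMem (by simp [*]),
      Set.ncard_pair hcz]
  have hcardS : 2 ≤ Nat.card ({a, b, c, z}ᶜ : Set V) := by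
    rw [Nat.card_coe_set_eq, ← Set.ncard_pair hpy]
    refine Set.ncard_le_ncard ?_
    rintro v (rfl | rfl) <;> assumption
  obtain ⟨A, F, h, hAF⟩ :=
    exists_isCoverPair (exists_adj_of_connected_induce htree.connected hcardS)
  obtain ⟨A', h', hpA, hA'⟩ := h.exists_mem_of_leaf hpS hyS ((hy p).2 (Or.inl rfl)).symm (by
    intro v hv hyv
    rcases (hy v).1 hyv with rfl | rfl
    · rfl
    · simp at hv)
  obtain ⟨h'', hpF⟩ := h'.extend_pendant_of_path hpA ha hb hc hy hz (Ne.symm hay) (Ne.symm hby)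
    (Ne.symm hcy) (Ne.symm haz) (Ne.symm hbz)
  have := h''.toidNumber_le
  have := Set.ncard_insert_le a (insert b (insert y A'))
  have := Set.ncard_insert_le b (insert y A')
  have := Set.ncard_insert_le y A'
  have := Set.ncard_insert_le s(p, a) (insert s(b, c) (insert s(y, z) (F \ {s(p, y)})))
  have := Set.ncard_insert_le s(b, c) (insert s(y, z) (F \ {s(p, y)}))
  have := Set.ncard_insert_le s(y, z) (F \ {s(p, y)})
  have := Set.ncard_sdiff_singleton_add_one hpF
  have := (ih ((Set.ne_univ_iff_exists_notMem _).2 ⟨b, by simp⟩) htree hcardS).le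
  omega

lemma IsPendantPathFamily.upperBound {V : Type u} [Finite V] {ι : Type*} [Finite ι] [Nonempty ι]
    {G : SimpleGraph V} (hG : G.IsTree) {p q : V} {f : ι × Fin 3 → V}
    (hf : IsPendantPathFamily G p f) (hpq : G.Adj p q) (hq : q ∉ Set.range f)
    (ih : ∀ {S : Set V}, S ≠ Set.univ → (G.induce S).IsTree → 2 ≤ Nat.card S →
      SatisfiesUpperBound (G.induce S)) :
    3 * toidNumber (subdivision G) + 2 ≤ 4 * Nat.card V ∧
      (3 * toidNumber (subdivision G) + 2 = 4 * Nat.card V →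
        InFamilyT (G.induce (Set.range f)ᶜ) ∧ HasNoStrongSupport (G.induce (Set.range f)ᶜ)) := by
  have htree : (G.induce (Set.range f)ᶜ).IsTree := by
    refine isTree_induce_of_gate hG hf.base_notMem ?_
    intro v hv w hw hvw
    obtain ⟨⟨i, j⟩, rfl⟩ := not_not.1 hw
    have hv' : ∀ ij, v ≠ f ij := fun ij h => hv ⟨ij, h.symm⟩
    fin_cases j
    · simpa [hv'] using (hf.adj_zero i v).1 hvw.symm
    · simpa [hv'] using (hf.adj_one i v).1 hvw.symm
    · simpa [hv'] using (hf.adj_two i v).1 hvw.symm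
  have hcardS : 2 ≤ Nat.card ((Set.range f)ᶜ : Set V) := by
    rw [Nat.card_coe_set_eq, ← Set.ncard_pair hpq.ne]
    refine Set.ncard_le_ncard ?_
    rintro v (rfl | rfl)
    exacts [hf.base_notMem, hq]
  have hcard := hf.card_compl
  have hγ := hf.toidNumber_le (exists_adj_of_connected_induce htree.connected hcardS)
  have hP := ih (by simp) htree hcardS
  have := hP.le
  exact ⟨by omega, fun _ => hP.of_eq (by omega)⟩

/-- `d` is the depth of the vertices of a tree rooted at `r`. -/
structure IsDepthFunction {V : Type u} (G : SimpleGraph V) (r : V) (d : V → ℕ) : Prop where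
  adj : ∀ {v w}, G.Adj v w → d v = d w + 1 ∨ d w = d v + 1
  exists_parent : ∀ {v}, v ≠ r → ∃ w, G.Adj v w ∧ d v = d w + 1
  parent_unique : ∀ {v w x}, G.Adj v w → G.Adj v x → d v = d w + 1 → d v = d x + 1 → w = x
  root : d r = 0

lemma isDepthFunction_dist {V : Type u} {G : SimpleGraph V} (hG : G.IsTree) (r : V) :
    IsDepthFunction G r (fun v => G.dist v r) where
  adj {v w} h := by
    simpa only [SimpleGraph.dist_comm (v := r)] using hG.dist_eq_dist_add_one_of_adj r h
  exists_parent {v} hv := by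
    obtain ⟨W, hW⟩ := hG.connected.exists_walk_length_eq_dist v r
    cases W with
    | nil => exact absurd rfl hv
    | cons h W =>
      refine ⟨_, h, ?_⟩
      have h1 := SimpleGraph.dist_le W
      rw [Walk.length_cons] at hW
      rcases hG.dist_eq_dist_add_one_of_adj r h with h2 | h2 <;>
        simp only [SimpleGraph.dist_comm (u := r)] at h2 <;> omega
  parent_unique {v w x} hw hx hdw hdx := by
    have key : ∀ {y} (h : G.Adj v y), G.dist v r = G.dist y r + 1 →
        ∃ P : G.Path v r, (P : G.Walk v r).snd = y := by
      intro y h hy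
      obtain ⟨W, hW⟩ := hG.connected.exists_walk_length_eq_dist y r
      exact ⟨⟨Walk.cons h W, Walk.isPath_of_length_eq_dist _ (by simp [hW, hy])⟩, by simp⟩
    obtain ⟨P, hP⟩ := key hw hdw
    obtain ⟨Q, hQ⟩ := key hx hdx
    rw [← hP, ← hQ, (hG.isAcyclic.subsingleton_path v r).elim P Q]
  root := SimpleGraph.dist_self

lemma exists_isLeafVert {V : Type u} [Finite V] {G : SimpleGraph V} (hG : G.IsTree)
    (hcard : 2 ≤ Nat.card V) : ∃ r, IsLeafVert G r := by
  classical
  have := Fintype.ofFinite V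
  have : Nontrivial V := Finite.one_lt_card_iff_nontrivial.1 hcard
  obtain ⟨r, hr⟩ := hG.exists_vert_degree_one_of_nontrivial
  exact ⟨r, degree_eq_one_iff_existsUnique_adj.1 hr⟩

/-- A path `p a b c` leading away from the root to a vertex `c` of maximal depth `h`, where `b`
has degree two. -/
structure IsDeepChain {V : Type u} (G : SimpleGraph V) (d : V → ℕ) (h : ℕ) (p a b c : V) :
    Prop where
  adj_a_p : G.Adj a p
  adj_b : ∀ v, G.Adj b v ↔ v = a ∨ v = c
  adj_c : ∀ v, G.Adj c v ↔ v = b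
  depth_p : d p + 3 = h
  depth_a : d a + 2 = h
  depth_b : d b + 1 = h
  depth_c : d c = h

namespace IsDepthFunction

variable {V : Type u} {G : SimpleGraph V} {r : V} {d : V → ℕ} {h : ℕ}

lemma adj_iff_of_max (hd : IsDepthFunction G r d) (hmax : ∀ v, d v ≤ h) {v w : V} (hv : d v = h)
    (hvw : G.Adj v w) (x : V) : G.Adj v x ↔ x = w := by
  refine ⟨fun hvx => ?_, fun hx => hx ▸ hvw⟩
  have := hd.adj hvw
  have := hd.adj hvx
  have := hmax w
  have := hmax x
  exact hd.parent_unique hvx hvw (by omega) (by omega)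

lemma two_le_height (hd : IsDepthFunction G r d) (hG : G.Connected) (hr : IsLeafVert G r)
    (hmax : ∀ v, d v ≤ h) (hcard : Nat.card V ≠ 2) : 2 ≤ h := by
  obtain ⟨w, hw, -⟩ := id hr
  by_contra hlt
  have := hd.adj hw
  have := hd.root
  have := hmax w
  exact hcard (card_eq_two_of_adj_leaves hG hw hr
    (isLeafVert_of_forall (hd.adj_iff_of_max hmax (by omega) hw.symm)))

lemma exists_isDeepChain (hd : IsDepthFunction G r d) (hr : IsLeafVert G r)
    (hmax : ∀ v, d v ≤ h) (hh : 2 ≤ h) (hred : HasNoStrongSupport G) {b c : V} (hc : d c = h)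
    (hbc : G.Adj b c) : ∃ p a, IsDeepChain G d h p a b c := by
  have hroot := hd.root
  have hadjc := hd.adj_iff_of_max hmax hc hbc.symm
  have hdb : d b + 1 = h := by
    have := hd.adj hbc
    have := hmax b
    omega
  obtain ⟨a, hba, hda⟩ := hd.exists_parent (v := b) (by
    rintro rfl
    omega)
  have hadjb : ∀ v, G.Adj b v ↔ v = a ∨ v = c := by
    intro v
    refine ⟨fun hbv => ?_, ?_⟩
    · rcases hd.adj hbv with h1 | h1
      · exact Or.inl (hd.parent_unique hbv hba h1 hda)
      · exact Or.inr (hred hbv hbc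
          (isLeafVert_of_forall (hd.adj_iff_of_max hmax (by omega) hbv.symm))
          (isLeafVert_of_forall hadjc))
    · rintro (rfl | rfl) <;> assumption
  have har : a ≠ r := by
    rintro rfl
    have := hred hba hbc hr (isLeafVert_of_forall hadjc)
    subst this
    omega
  obtain ⟨p, hap, hdp⟩ := hd.exists_parent har
  exact ⟨p, a, hap, hadjb, hadjc, by omega, by omega, hdb, hc⟩

end IsDepthFunction

lemma notMem_range_of_chains {V : Type u} {ι : Type*} {G : SimpleGraph V} {d : V → ℕ}
    {h : ℕ} {p x : V} {a b c : ι → V} (hchain : ∀ i, IsDeepChain G d h p (a i) (b i) (c i))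
    (hx : d x ≤ d p) :
    x ∉ Set.range (fun ij : ι × Fin 3 => ![a ij.1, b ij.1, c ij.1] ij.2) := by
  rintro ⟨⟨i, j⟩, hij⟩
  have h1 := hchain i
  have e1 := h1.depth_a
  have e2 := h1.depth_b
  have e3 := h1.depth_c
  have e4 := h1.depth_p
  have hd := congrArg d hij
  fin_cases j <;> simp at hd <;> omega

lemma isPendantPathFamily_of_chains {V : Type u} {ι : Type*} {G : SimpleGraph V} {d : V → ℕ}
    {h : ℕ} {p : V} {a b c : ι → V} (ha : Function.Injective a)
    (hchain : ∀ i, IsDeepChain G d h p (a i) (b i) (c i))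
    (hdeg : ∀ i v, G.Adj (a i) v ↔ v = p ∨ v = b i) :
    IsPendantPathFamily G p (fun ij : ι × Fin 3 => ![a ij.1, b ij.1, c ij.1] ij.2) where
  inj := by
    have hb : ∀ i j, b i = b j → i = j := by
      intro i j hij
      have h1 := ((hchain i).adj_b (a i)).2 (Or.inl rfl)
      rw [hij] at h1
      rcases ((hchain j).adj_b (a i)).1 h1 with h2 | h2
      · exact ha h2
      · have := (hchain i).depth_a
        have := (hchain j).depth_c
        rw [h2] at *
        omega
    have hc : ∀ i j, c i = c j → i = j := by
      intro i j hij
      have h1 := ((hchain i).adj_c (b i)).2 rfl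
      rw [hij] at h1
      exact hb i j (((hchain j).adj_c (b i)).1 h1)
    rintro ⟨i, x⟩ ⟨j, y⟩ hij
    have h1 := hchain i
    have h2 := hchain j
    have e1 := h1.depth_a
    have e2 := h1.depth_b
    have e3 := h1.depth_c
    have e4 := h2.depth_a
    have e5 := h2.depth_b
    have e6 := h2.depth_c
    have hd := congrArg d hij
    fin_cases x <;> fin_cases y <;> simp at hij hd ⊢
    · exact ha hij
    · omega
    · omega
    · omega
    · exact hb i j hij
    · omega
    · omega
    · omega
    · exact hc i j hij
  base_notMem := notMem_range_of_chains hchain le_rfl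
  adj_zero i v := by simpa using hdeg i v
  adj_one i v := by simpa using (hchain i).adj_b v
  adj_two i v := by simpa using (hchain i).adj_c v

lemma IsDeepChain.three_mul_toidNumber_lt {V : Type u} [Finite V] {G : SimpleGraph V}
    (hG : G.IsTree) {r : V} {d : V → ℕ} {h : ℕ} (hd : IsDepthFunction G r d)
    (hmax : ∀ v, d v ≤ h) {p a b c : V} (hch : IsDeepChain G d h p a b c)
    (hA : IsLeafVert G p ∨ ∃ y, G.Adj a y ∧ y ≠ p ∧ y ≠ b)
    (ih : ∀ {S : Set V}, S ≠ Set.univ → (G.induce S).IsTree → 2 ≤ Nat.card S →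
      SatisfiesUpperBound (G.induce S)) :
    3 * toidNumber (subdivision G) + 2 < 4 * Nat.card V := by
  have hdp := hch.depth_p
  have hda := hch.depth_a
  have hdb := hch.depth_b
  have hdc := hch.depth_c
  have hmem : ∀ v, d v + 1 < h → v ∈ ({b, c}ᶜ : Set V) := by
    rintro v hv (rfl | rfl) <;> omega
  have haS := hmem a (by omega)
  have hpS := hmem p (by omega)
  refine three_mul_toidNumber_lt_of_pendant hG hch.adj_b hch.adj_c hch.adj_a_p ?_ ?_ ih
  · rintro rfl
    omega
  intro A F hAF
  rcases hA with hp | ⟨y, hay, hyp, hyb⟩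
  · obtain ⟨A', h1, h2, h3⟩ := hAF.exists_mem_of_leaf haS hpS hch.adj_a_p
      fun v _ hv => (hp.adj_iff hch.adj_a_p.symm v).1 hv
    exact ⟨A', F, h1, h2, by omega⟩
  · have hdy : d y = d a + 1 := by
      rcases hd.adj hay with h1 | h1
      · exact absurd (hd.parent_unique hay hch.adj_a_p h1 (by omega)) hyp
      · exact h1
    have hyS : y ∈ ({b, c}ᶜ : Set V) := by
      rintro (rfl | rfl)
      · exact hyb rfl
      · omega
    by_cases hy : ∃ z, G.Adj y z ∧ z ≠ a
    · obtain ⟨z, hyz, hza⟩ := hy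
      have hdz : d z = h := by
        rcases hd.adj hyz with h1 | h1
        · exact absurd (hd.parent_unique hyz hay.symm h1 hdy) hza
        · omega
      have hzS : z ∈ ({b, c}ᶜ : Set V) := by
        rintro (rfl | rfl)
        · omega
        · exact hyb ((hch.adj_c y).1 hyz.symm)
      exact hAF.exists_mem_of_pendant haS hyS hzS hpS hay hza
        (fun v _ hv => (hd.adj_iff_of_max hmax hdz hyz.symm v).1 hv) hch.adj_a_p hyp.symm
    · obtain ⟨A', h1, h2, h3⟩ := hAF.exists_mem_of_leaf haS hyS hay
        fun v _ hv => by_contra fun hne => hy ⟨v, hv, hne⟩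
      exact ⟨A', F, h1, h2, by omega⟩

lemma satisfiesUpperBound_of_card_eq_two {V : Type u} [Finite V] {G : SimpleGraph V}
    (hG : G.IsTree) (hcard : Nat.card V = 2) : SatisfiesUpperBound G := by
  have : Nontrivial V := Finite.one_lt_card_iff_nontrivial.1 (by omega)
  obtain ⟨x⟩ := hG.connected.nonempty
  obtain ⟨y, hxy⟩ := hG.preconnected.exists_adj_of_nontrivial x
  have huniv : ∀ v, v = x ∨ v = y := by
    have h1 : ({x, y} : Set V) = Set.univ :=
      Set.eq_of_subset_of_ncard_le (Set.subset_univ _)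
        (by rw [Set.ncard_univ, hcard, Set.ncard_pair hxy.ne])
    intro v
    exact h1.symm.subset (Set.mem_univ v)
  have hpair : IsCoverPair G Set.univ {x} {s(x, y)} := by
    have := Sym2.eq_swap (a := x) (b := y)
    have := hxy.symm
    refine ⟨?_, ?_, ?_⟩
    · intro v _
      rcases huniv v with rfl | rfl
      · exact ⟨y, trivial, hxy, rfl⟩
      · exact ⟨x, trivial, hxy.symm, Sym2.eq_swap⟩
    · intro v _ w _ hvw
      have := hvw.ne
      have := huniv v
      have := huniv w
      simp only [Set.mem_singleton_iff]
      grind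
    · intro v _ w _ hvw
      have := hvw.ne
      have := huniv v
      have := huniv w
      simp only [Set.mem_singleton_iff]
      grind
  have hγ := hpair.toidNumber_le
  rw [Set.ncard_singleton, Set.ncard_singleton] at hγ
  have hl : leafCount G = 1 := if_pos hcard
  have hs : supportCount G = 1 := if_pos hcard
  have hbij : Function.Bijective ![x, y] := by
    constructor
    · intro i j hij
      have := hxy.ne
      fin_cases i <;> fin_cases j <;> simp_all
    · intro v
      rcases huniv v with rfl | rfl
      exacts [⟨0, rfl⟩, ⟨1, rfl⟩]
  have hadj : ∀ i j, G.Adj (![x, y] i) (![x, y] j) ↔ (pathGraph 2).Adj i j := by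
    intro i j
    fin_cases i <;> fin_cases j <;> simp [pathGraph_adj, hxy, hxy.symm]
  exact ⟨by omega, fun _ =>
    InFamilyT.base G (RelIso.symm ⟨Equiv.ofBijective _ hbij, @fun i j => hadj i j⟩)⟩

lemma inFamilyT_of_chains {V : Type u} [Finite V] {G : SimpleGraph V} (hG : G.IsTree)
    {d : V → ℕ} {h : ℕ} {p q : V} (hpq : G.Adj p q) (hdq : d q + 1 = d p)
    (hchain : ∀ y, G.Adj p y → y ≠ q → ∃ b c, IsDeepChain G d h p y b c ∧
      ∀ v, G.Adj y v ↔ v = p ∨ v = b)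
    (hp : ∃ y, G.Adj p y ∧ y ≠ q)
    (ih : ∀ {S : Set V}, S ≠ Set.univ → (G.induce S).IsTree → 2 ≤ Nat.card S →
      SatisfiesUpperBound (G.induce S))
    (heq : 3 * toidNumber (subdivision G) + 2 = 4 * Nat.card V) : InFamilyT G := by
  obtain ⟨k, ⟨e⟩⟩ := Finite.exists_equiv_fin {y // G.Adj p y ∧ y ≠ q}
  have hk : k ≠ 0 := by
    rintro rfl
    obtain ⟨y, hy⟩ := hp
    exact (e ⟨y, hy⟩).elim0
  have : Nonempty (Fin k) := ⟨⟨0, Nat.pos_of_ne_zero hk⟩⟩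
  choose b c hbc hdeg using fun i => hchain (e.symm i) (e.symm i).2.1 (e.symm i).2.2
  have hf := isPendantPathFamily_of_chains
    (Subtype.val_injective.comp e.symm.injective) hbc hdeg
  set f : Fin k × Fin 3 → V :=
    fun ij => ![(Subtype.val ∘ e.symm) ij.1, b ij.1, c ij.1] ij.2 with hfdef
  have hq : q ∉ Set.range f := notMem_range_of_chains hbc (by omega)
  obtain ⟨hT', hred⟩ := (hf.upperBound hG hpq hq ih).2 heq
  have hleaf : IsLeafVert (G.induce (Set.range f)ᶜ) ⟨p, hf.base_notMem⟩ := by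
    refine ⟨⟨q, hq⟩, hpq, ?_⟩
    rintro ⟨v, hv⟩ hpv
    refine Subtype.ext (by_contra fun hne => hv ⟨(e ⟨v, hpv, hne⟩, 0), ?_⟩)
    simp [hfdef]
  have hweak := hred.isWeakLeaf hleaf
  by_cases hk1 : k = 1
  · subst hk1
    obtain ⟨iso⟩ := hf.nonempty_iso_attachPath
    exact InFamilyT.op2 (Or.inr hweak) hT' G iso
  · obtain ⟨iso⟩ := hf.nonempty_iso_attachQ
    exact InFamilyT.op3 hweak hT' (by omega) G iso

lemma HasNoStrongSupport.three_mul_toidNumber_le {V : Type u} [Finite V] {G : SimpleGraph V}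
    (hred : HasNoStrongSupport G) (hG : G.IsTree) (hcard : 2 < Nat.card V)
    (ih : ∀ {S : Set V}, S ≠ Set.univ → (G.induce S).IsTree → 2 ≤ Nat.card S →
      SatisfiesUpperBound (G.induce S)) :
    3 * toidNumber (subdivision G) + 2 ≤ 4 * Nat.card V ∧
      (3 * toidNumber (subdivision G) + 2 = 4 * Nat.card V → InFamilyT G) := by
  obtain ⟨r, hr⟩ := exists_isLeafVert hG hcard.le
  obtain ⟨d, hd⟩ : ∃ d, IsDepthFunction G r d := ⟨_, isDepthFunction_dist hG r⟩
  have : Nonempty V := ⟨r⟩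
  obtain ⟨c, hc⟩ := Finite.exists_max d
  obtain ⟨h, hch⟩ : ∃ h, h = d c := ⟨_, rfl⟩
  have hmax : ∀ v, d v ≤ h := fun v => hch ▸ hc v
  have hh := hd.two_le_height hG.connected hr hmax (by omega)
  have hroot := hd.root
  obtain ⟨b, hcb, -⟩ := hd.exists_parent (v := c) (by
    rintro rfl
    omega)
  obtain ⟨p, a, hchain⟩ := hd.exists_isDeepChain hr hmax hh hred hch.symm hcb.symm
  by_cases hstrict : 3 * toidNumber (subdivision G) + 2 < 4 * Nat.card V
  · exact ⟨hstrict.le, fun h' => absurd h' hstrict.ne⟩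
  have hdeg : ∀ {p a b c}, IsDeepChain G d h p a b c → ∀ v, G.Adj a v ↔ v = p ∨ v = b := by
    intro p a b c hch v
    refine ⟨fun hav => ?_, ?_⟩
    · by_contra! hne
      exact hstrict (hch.three_mul_toidNumber_lt hG hd hmax (Or.inr ⟨v, hav, hne⟩) ih)
    · rintro (rfl | rfl)
      · exact hch.adj_a_p
      · exact ((hch.adj_b a).2 (Or.inl rfl)).symm
  have hpleaf : ¬ IsLeafVert G p := fun hp =>
    hstrict (hchain.three_mul_toidNumber_lt hG hd hmax (Or.inl hp) ih)
  have hda := hchain.depth_a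
  have hdp := hchain.depth_p
  obtain ⟨q, hpq, hdq⟩ := hd.exists_parent (v := p) (by
    rintro rfl
    exact hpleaf hr)
  have haq : a ≠ q := by
    rintro rfl
    omega
  have hf := isPendantPathFamily_of_chains (ι := Fin 1) (a := fun _ => a) (b := fun _ => b)
    (c := fun _ => c) (Function.injective_of_subsingleton _) (fun _ => hchain)
    (fun _ => hdeg hchain)
  have hq := notMem_range_of_chains (ι := Fin 1) (fun _ => hchain) (x := q) (by omega)
  obtain ⟨hle, heq⟩ := hf.upperBound hG hpq hq ih
  refine ⟨hle, fun hγ => ?_⟩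
  by_cases hall : ∀ y, G.Adj p y → y ≠ q → ∃ b c, IsDeepChain G d h p y b c
  · refine inFamilyT_of_chains (h := h) hG hpq hdq.symm (fun y hy hyq => ?_)
      ⟨a, hchain.adj_a_p.symm, haq⟩ ih hγ
    obtain ⟨b, c, hbc⟩ := hall y hy hyq
    exact ⟨b, c, hbc, hdeg hbc⟩
  push Not at hall
  obtain ⟨y, hpy, hyq, hy⟩ := hall
  have hdb := hchain.depth_b
  have hdc := hchain.depth_c
  have hya : y ≠ a := by
    rintro rfl
    exact hy b c hchain
  have hdy : d y = d p + 1 := by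
    rcases hd.adj hpy with h1 | h1
    · exact absurd (hd.parent_unique hpy hpq h1 hdq) hyq
    · exact h1
  by_cases hyleaf : ∀ z, G.Adj y z → z = p
  · obtain ⟨hT', -⟩ := heq hγ
    obtain ⟨iso⟩ := hf.nonempty_iso_attachPath
    refine InFamilyT.op2 (Or.inl ⟨⟨y, ?_⟩, hpy, ⟨p, hf.base_notMem⟩, hpy.symm,
      fun z hz => Subtype.ext (hyleaf z hz)⟩) hT' G iso
    rintro ⟨⟨i, x⟩, hx⟩
    fin_cases x <;> simp at hx
    · exact hya hx.symm
    · subst hx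
      omega
    · subst hx
      omega
  · exfalso
    push Not at hyleaf
    obtain ⟨z, hyz, hzp⟩ := hyleaf
    have hdown : ∀ {x}, G.Adj y x → x ≠ p → d x = d y + 1 := by
      intro x hyx hxp
      rcases hd.adj hyx with h1 | h1
      · exact absurd (hd.parent_unique hyx hpy.symm h1 hdy) hxp
      · exact h1
    have hleaf : ∀ {x}, G.Adj y x → x ≠ p → ∀ v, G.Adj x v ↔ v = y := by
      intro x hyx hxp v
      refine ⟨fun hxv => by_contra fun hvy => ?_, fun hv => hv ▸ hyx.symm⟩
      have hdx := hdown hyx hxp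
      have hdv : d v = h := by
        rcases hd.adj hxv with h1 | h1
        · exact absurd (hd.parent_unique hxv hyx.symm h1 hdx) hvy
        · omega
      obtain ⟨p', a', hch⟩ := hd.exists_isDeepChain hr hmax hh hred hdv hxv
      obtain rfl : y = a' := (((hch.adj_b y).1 hyx.symm).resolve_right (Ne.symm hvy))
      have := hch.depth_p
      obtain rfl : p = p' := hd.parent_unique hpy.symm hch.adj_a_p hdy (by omega)
      exact hy x v hch
    have hadjy : ∀ v, G.Adj y v ↔ v = p ∨ v = z := by
      intro v
      refine ⟨fun hyv => or_iff_not_imp_left.2 fun hvp => hred hyv hyz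
        (isLeafVert_of_forall (hleaf hyv hvp)) (isLeafVert_of_forall (hleaf hyz hzp)), ?_⟩
      rintro (rfl | rfl)
      exacts [hpy.symm, hyz]
    have hzb : z ≠ b := by
      rintro rfl
      exact hya ((hleaf hyz hzp a).1 ((hchain.adj_b a).2 (Or.inl rfl))).symm
    have hdz := hdown hyz hzp
    refine hstrict (three_mul_toidNumber_lt_of_path_of_support hG (hdeg hchain) hchain.adj_b
      hchain.adj_c hadjy (hleaf hyz hzp) ?_ ih)
    have hne : ∀ {v w}, d v ≠ d w → v ≠ w := fun h1 h2 => h1 (congrArg d h2)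
    simp only [List.nodup_cons, List.mem_cons, List.not_mem_nil, not_or, or_false,
      List.nodup_nil, not_false_eq_true, and_true]
    refine ⟨⟨?_, ?_, ?_, ?_, ?_⟩, ⟨?_, ?_, hya.symm, ?_⟩, ⟨?_, ?_, hzb.symm⟩, ⟨?_, ?_⟩, ?_⟩ <;>
      exact hne (by omega)

lemma satisfiesUpperBound_of_isTree {V : Type u} [Finite V] {G : SimpleGraph V} (hG : G.IsTree)
    (hcard : 2 ≤ Nat.card V) : SatisfiesUpperBound G := by
  obtain ⟨n, hn⟩ : ∃ n, n = Nat.card V := ⟨_, rfl⟩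
  induction n using Nat.strong_induction_on generalizing V with
  | _ n IH =>
    have ih : ∀ {S : Set V}, S ≠ Set.univ → (G.induce S).IsTree → 2 ≤ Nat.card S →
        SatisfiesUpperBound (G.induce S) := by
      intro S hS htree hS2
      refine IH _ ?_ htree hS2 rfl
      rw [hn, Nat.card_coe_set_eq, ← Set.ncard_univ]
      exact Set.ncard_lt_ncard (Set.ssubset_univ_iff.2 hS)
    rcases hcard.eq_or_lt with h2 | h2
    · exact satisfiesUpperBound_of_card_eq_two hG h2.symm
    by_cases hred : HasNoStrongSupport G
    · obtain ⟨h3, h4⟩ := hred.three_mul_toidNumber_le hG h2 ih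
      exact hred.satisfiesUpperBound h3 h4
    · unfold HasNoStrongSupport at hred
      push Not at hred
      obtain ⟨u, x, y, hux, huy, hx, hy, hxy⟩ := hred
      exact satisfiesUpperBound_of_two_leaves hG hxy (hx.adj_iff hux.symm) (hy.adj_iff huy.symm) ih

theorem upper_equality_implies_familyT {V : Type u} [Fintype V]
    (T : SimpleGraph V) (hT : T.IsTree) (hn : 2 ≤ Nat.card V)
    (heq : (toidNumber (subdivision T) : ℚ) = (4 * (Nat.card V : ℚ) - leafCount T + supportCount T - 2) / 3) :
    InFamilyT T := by
  refine (satisfiesUpperBound_of_isTree hT hn).2 ?_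
  have : (3 * toidNumber (subdivision T) + leafCount T + 2 : ℚ) =
      4 * Nat.card V + supportCount T := by
    rw [heq]
    ring
  exact_mod_cast this
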